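/- arXiv:1510.09102 — 7 statements merged into one kernel-verified Lean document; each statement's English description precedes it below -/
import Mathlib

section
/- For every labelled MDP D and every strategy α of D there exists a trace-based strategy β of D such that subDis_{D,α}(w) = subDis_{D,β}(w) for all traces w ∈ L*; in particular, Tr_{D,α} = Tr_{D,β}. -/
open Matrix

/-- A labelled Markov decision process (data part): an initial distribution,
a finite nonempty set of available moves at each state, and for each move a
probability distribution on `L × Q`. -/
structure PreMDP (Q L M : Type*) where
  init : Q → ℝ
  moves : Q → Finset M
  prob : M → L → Q → ℝ

/-- The well-formedness conditions making a `PreMDP` a labelled MDP. -/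
def IsMDP {Q L M : Type*} [Fintype Q] [Fintype L] (D : PreMDP Q L M) : Prop :=
  (∀ q, 0 ≤ D.init q) ∧ (∑ q, D.init q = 1) ∧
  (∀ q, (D.moves q).Nonempty) ∧
  (∀ m a q', 0 ≤ D.prob m a q') ∧
  (∀ q, ∀ m ∈ D.moves q, ∑ a : L, ∑ q' : Q, D.prob m a q' = 1)

/-- A path `q0 a1 q1 ⋯ an qn`: the initial state together with the list of
(label, state) steps. -/
abbrev MPath (Q L : Type*) := Q × List (L × Q)

/-- The last state of a path. -/
def MPath.last {Q L : Type*} (ρ : MPath Q L) : Q :=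
  (ρ.2.getLast?).elim ρ.1 Prod.snd

/-- The trace of a path. -/
def MPath.trace {Q L : Type*} (ρ : MPath Q L) : List L := ρ.2.map Prod.fst

/-- A strategy: to each path a probability distribution on the moves available
at its last state. -/
def IsStrategy {Q L M : Type*} (D : PreMDP Q L M) (α : MPath Q L → M → ℝ) : Prop :=
  ∀ ρ : MPath Q L, (∀ m, 0 ≤ α ρ m) ∧ (∀ m, m ∉ D.moves (MPath.last ρ) → α ρ m = 0) ∧
    (∑ m ∈ D.moves (MPath.last ρ), α ρ m = 1)

/-- A strategy is trace-based if it depends only on the trace and the last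
state of the path. -/
def TraceBased {Q L M : Type*} (α : MPath Q L → M → ℝ) : Prop :=
  ∀ ρ ρ' : MPath Q L, MPath.trace ρ = MPath.trace ρ' → MPath.last ρ = MPath.last ρ' → α ρ = α ρ'

/-- Probability of performing the given further steps, starting from the path `ρ`. -/
def probFrom {Q L M : Type*} (D : PreMDP Q L M) (α : MPath Q L → M → ℝ) :
    MPath Q L → List (L × Q) → ℝ
  | _, [] => 1
  | ρ, (a, q) :: rest =>
      (∑ m ∈ D.moves (MPath.last ρ), α ρ m * D.prob m a q) *
        probFrom D α (ρ.1, ρ.2 ++ [(a, q)]) rest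

/-- The probability `Pr_{D,α}(ρ)` of a path. -/
def pathProb {Q L M : Type*} (D : PreMDP Q L M) (α : MPath Q L → M → ℝ) (ρ : MPath Q L) : ℝ :=
  D.init ρ.1 * probFrom D α (ρ.1, []) ρ.2

/-- `subDis D α w q` : the total probability of paths with trace `w` ending in `q`. -/
def subDis {Q L M : Type*} [Fintype Q] [DecidableEq Q] (D : PreMDP Q L M)
    (α : MPath Q L → M → ℝ) (w : List L) (q : Q) : ℝ :=
  ∑ q0 : Q, ∑ f : Fin w.length → Q,
    if MPath.last ((q0, List.ofFn fun i => (w.get i, f i)) : MPath Q L) = q then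
      pathProb D α (q0, List.ofFn fun i => (w.get i, f i)) else 0

/-- The trace-probability function `Tr_{D,α}`. -/
def Tr {Q L M : Type*} [Fintype Q] [DecidableEq Q] (D : PreMDP Q L M)
    (α : MPath Q L → M → ℝ) (w : List L) : ℝ :=
  ∑ q : Q, subDis D α w q

/-- A local strategy: to each state a probability distribution on the moves
available there. -/
def IsLocal {Q L M : Type*} (D : PreMDP Q L M) (β : Q → M → ℝ) : Prop :=
  ∀ q, (∀ m, 0 ≤ β q m) ∧ (∀ m, m ∉ D.moves q → β q m = 0) ∧ (∑ m ∈ D.moves q, β q m = 1)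

/-- The transition matrix `Δ_β(a)` of a local strategy `β` and label `a`. -/
def transMat {Q L M : Type*} (D : PreMDP Q L M) (β : Q → M → ℝ) (a : L) : Matrix Q Q ℝ :=
  Matrix.of fun q q' => ∑ m ∈ D.moves q, β q m * D.prob m a q'

/-- `Succ(μ, β, a) = μ · Δ_β(a)`. -/
def Succ {Q L M : Type*} [Fintype Q] (D : PreMDP Q L M) (μ : Q → ℝ) (β : Q → M → ℝ)
    (a : L) : Q → ℝ :=
  Matrix.vecMul μ (transMat D β a)

/-- Subdistributions over `Q` (viewed as row vectors). -/
def IsSubDist {Q : Type*} [Fintype Q] (μ : Q → ℝ) : Prop :=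
  (∀ q, 0 ≤ μ q) ∧ (∑ q, μ q) ≤ 1

/-- A bisimulation between (sub)distributions of two MDPs. -/
def IsBisim {Q Q' L M M' : Type*} [Fintype Q] [Fintype Q'] (D : PreMDP Q L M)
    (E : PreMDP Q' L M') (R : (Q → ℝ) → (Q' → ℝ) → Prop) : Prop :=
  ∀ μ ν, R μ ν →
    ((∑ q, μ q) = (∑ q, ν q)) ∧
    (∀ β, IsLocal D β → ∃ γ, IsLocal E γ ∧ ∀ a, R (Succ D μ β a) (Succ E ν γ a)) ∧
    (∀ γ, IsLocal E γ → ∃ β, IsLocal D β ∧ ∀ a, R (Succ D μ β a) (Succ E ν γ a))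

/-- `μ ∼ ν`: the largest bisimulation (union of all bisimulations). -/
def Bisim {Q Q' L M M' : Type*} [Fintype Q] [Fintype Q'] (D : PreMDP Q L M)
    (E : PreMDP Q' L M') (μ : Q → ℝ) (ν : Q' → ℝ) : Prop :=
  ∃ R, IsBisim D E R ∧ R μ ν

/-- The approximants `∼ₙ` of the bisimulation relation. -/
def simN {Q L M : Type*} [Fintype Q] (D : PreMDP Q L M) : ℕ → (Q → ℝ) → (Q → ℝ) → Prop
  | 0 => fun μ ν => (∑ q, μ q) = (∑ q, ν q)
  | n + 1 => fun μ ν =>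
      ((∑ q, μ q) = (∑ q, ν q)) ∧
      (∀ β, IsLocal D β → ∃ γ, IsLocal D γ ∧ ∀ a, simN D n (Succ D μ β a) (Succ D ν γ a)) ∧
      (∀ γ, IsLocal D γ → ∃ β, IsLocal D β ∧ ∀ a, simN D n (Succ D μ β a) (Succ D ν γ a))

/-- The point `p(μ, β) ∈ ℝ^{L × k}`: the concatenation of the row vectors
`μ · Δ_β(a) · B` for `a ∈ L`. -/
def point {Q L M : Type*} {k : ℕ} [Fintype Q] (D : PreMDP Q L M) (B : Matrix Q (Fin k) ℝ)
    (μ : Q → ℝ) (β : Q → M → ℝ) : L × Fin k → ℝ :=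
  fun x => Matrix.vecMul (Matrix.vecMul μ (transMat D β x.1)) B x.2

/-- `β̂` is extremal in direction `v` with respect to `B`. -/
def ExtremalIn {Q L M : Type*} {k : ℕ} [Fintype Q] [Fintype L] [Fintype M] [DecidableEq Q]
    (D : PreMDP Q L M) (B : Matrix Q (Fin k) ℝ) (βh : Q → M → ℝ) (v : L × Fin k → ℝ) : Prop :=
  ∀ q : Q, ∀ β, IsLocal D β →
    point D B (Pi.single q 1) β ⬝ᵥ v ≤ point D B (Pi.single q 1) βh ⬝ᵥ v ∧
    (point D B (Pi.single q 1) β ⬝ᵥ v = point D B (Pi.single q 1) βh ⬝ᵥ v →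
      point D B (Pi.single q 1) β = point D B (Pi.single q 1) βh)

/-- `β̂` is extremal with respect to `B`: extremal in some direction. -/
def Extremal {Q L M : Type*} {k : ℕ} [Fintype Q] [Fintype L] [Fintype M] [DecidableEq Q]
    (D : PreMDP Q L M) (B : Matrix Q (Fin k) ℝ) (βh : Q → M → ℝ) : Prop :=
  ∃ v, ExtremalIn D B βh v

/-- The polytope `P_μ = { p(μ, β) : β a local strategy }`. -/
def Pset {Q L M : Type*} {k : ℕ} [Fintype Q] (D : PreMDP Q L M) (B : Matrix Q (Fin k) ℝ)
    (μ : Q → ℝ) : Set (L × Fin k → ℝ) :=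
  { x | ∃ β, IsLocal D β ∧ x = point D B μ β }

/-- Column space of a matrix. -/
def colSpace {Q : Type*} {k : ℕ} (B : Matrix Q (Fin k) ℝ) : Submodule ℝ (Q → ℝ) :=
  Submodule.span ℝ (Set.range fun j => fun q => B q j)

/-- The sum of `F ρ` over all paths `ρ` with trace `w`. -/
def tracePathSum {Q L : Type*} [Fintype Q] (w : List L) (F : MPath Q L → ℝ) : ℝ :=
  ∑ q0 : Q, ∑ f : Fin w.length → Q, F (q0, List.ofFn fun i => (w.get i, f i))

section TracePathSum

variable {Q L : Type*}

theorem MPath.last_concat (q0 : Q) (l : List (L × Q)) (a : L) (q : Q) :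
    MPath.last ((q0, l ++ [(a, q)]) : MPath Q L) = q := by
  simp [MPath.last]

variable [Fintype Q]

theorem tracePathSum_ofFn {n : ℕ} (w : Fin n → L) (F : MPath Q L → ℝ) :
    tracePathSum (List.ofFn w) F =
      ∑ q0 : Q, ∑ f : Fin n → Q, F (q0, List.ofFn fun i => (w i, f i)) := by
  have h : (⟨(List.ofFn w).length, (List.ofFn w).get⟩ : Σ n, Fin n → L) = ⟨n, w⟩ :=
    List.equivSigmaTuple.apply_symm_apply ⟨n, w⟩
  unfold tracePathSum
  generalize (List.ofFn w).get = v at h ⊢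
  revert v
  generalize (List.ofFn w).length = k
  rintro v ⟨⟩
  rfl

theorem tracePathSum_concat (w : List L) (a : L) (F : MPath Q L → ℝ) :
    tracePathSum (w ++ [a]) F =
      tracePathSum w fun ρ => ∑ q : Q, F (ρ.1, ρ.2 ++ [(a, q)]) := by
  have hw : w ++ [a] = List.ofFn (Fin.snoc w.get a : Fin (w.length + 1) → L) := by
    simp [List.ofFn_succ', -List.ofFn_succ]
  rw [hw, tracePathSum_ofFn]
  refine Finset.sum_congr rfl fun q0 _ => ?_
  rw [← (Fin.snocEquiv fun _ : Fin (w.length + 1) => Q).sum_comp, Fintype.sum_prod_type_right]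
  refine Finset.sum_congr rfl fun f _ => Finset.sum_congr rfl fun q _ => ?_
  simp [List.ofFn_succ', Fin.snocEquiv, -List.ofFn_succ]

theorem tracePathSum_congr {w : List L} {F G : MPath Q L → ℝ}
    (h : ∀ ρ, MPath.trace ρ = w → F ρ = G ρ) : tracePathSum w F = tracePathSum w G := by
  refine Finset.sum_congr rfl fun q0 _ => Finset.sum_congr rfl fun f _ => h _ ?_
  simp [MPath.trace, List.map_ofFn, Function.comp_def]

theorem tracePathSum_nonneg {w : List L} {F : MPath Q L → ℝ} (h : ∀ ρ, 0 ≤ F ρ) :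
    0 ≤ tracePathSum w F :=
  Finset.sum_nonneg fun _ _ => Finset.sum_nonneg fun _ _ => h _

theorem tracePathSum_sum {ι : Type*} (s : Finset ι) (w : List L) (F : ι → MPath Q L → ℝ) :
    tracePathSum w (fun ρ => ∑ i ∈ s, F i ρ) = ∑ i ∈ s, tracePathSum w (F i) := by
  simp only [tracePathSum]
  rw [Finset.sum_comm (s := s)]
  exact Finset.sum_congr rfl fun q0 _ => Finset.sum_comm

theorem tracePathSum_mul_const (w : List L) (F : MPath Q L → ℝ) (c : ℝ) :
    tracePathSum w (fun ρ => F ρ * c) = tracePathSum w F * c := by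
  simp only [tracePathSum, Finset.sum_mul]

end TracePathSum

section SubDis

variable {Q L M : Type*} {D : PreMDP Q L M} {α : MPath Q L → M → ℝ}

theorem probFrom_concat (a : L) (q : Q) (l : List (L × Q)) (ρ : MPath Q L) :
    probFrom D α ρ (l ++ [(a, q)]) = probFrom D α ρ l *
      ∑ m ∈ D.moves (MPath.last (ρ.1, ρ.2 ++ l)), α (ρ.1, ρ.2 ++ l) m * D.prob m a q := by
  induction l generalizing ρ with
  | nil => simp [probFrom]
  | cons x l ih =>
    obtain ⟨b, r⟩ := x
    simp only [List.cons_append, probFrom, ih, mul_assoc, List.append_assoc, List.nil_append]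

theorem pathProb_concat (ρ : MPath Q L) (a : L) (q : Q) :
    pathProb D α (ρ.1, ρ.2 ++ [(a, q)]) = pathProb D α ρ *
      ∑ m ∈ D.moves (MPath.last ρ), α ρ m * D.prob m a q := by
  simp [pathProb, probFrom_concat, mul_assoc]

variable [Fintype Q]

theorem pathProb_nonneg [Fintype L] (hD : IsMDP D) (hα : IsStrategy D α) (ρ : MPath Q L) :
    0 ≤ pathProb D α ρ := by
  have probFrom_nonneg (l : List (L × Q)) : ∀ ρ, 0 ≤ probFrom D α ρ l := by
    induction l with
    | nil => simp [probFrom]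
    | cons x l ih =>
      exact fun ρ => mul_nonneg (Finset.sum_nonneg fun m _ =>
        mul_nonneg ((hα ρ).1 m) (hD.2.2.2.1 m _ _)) (ih _)
  exact mul_nonneg (hD.1 _) (probFrom_nonneg _ _)

variable [DecidableEq Q]

theorem subDis_eq_tracePathSum (D : PreMDP Q L M) (α : MPath Q L → M → ℝ) (w : List L) (q : Q) :
    subDis D α w q = tracePathSum w fun ρ => if MPath.last ρ = q then pathProb D α ρ else 0 :=
  rfl

/-- The total probability of following a path with trace `w` that ends in `q`
and then choosing the move `m`. -/
def moveMass (D : PreMDP Q L M) (α : MPath Q L → M → ℝ) (w : List L) (q : Q) (m : M) : ℝ :=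
  tracePathSum w fun ρ => if MPath.last ρ = q then pathProb D α ρ * α ρ m else 0

theorem subDis_concat (w : List L) (a : L) (q : Q) :
    subDis D α (w ++ [a]) q =
      ∑ r, ∑ m ∈ D.moves r, moveMass D α w r m * D.prob m a q := by
  simp only [subDis_eq_tracePathSum, moveMass, ← tracePathSum_mul_const, ← tracePathSum_sum, tracePathSum_concat,
    MPath.last_concat, pathProb_concat]
  refine tracePathSum_congr fun ρ _ => ?_
  rw [Finset.sum_ite_eq' Finset.univ q, if_pos (Finset.mem_univ q),
    Finset.sum_eq_single_of_mem (MPath.last ρ) (Finset.mem_univ _)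
      fun r _ hr => Finset.sum_eq_zero fun m _ => by rw [if_neg hr.symm, zero_mul],
    Finset.mul_sum]
  exact Finset.sum_congr rfl fun m _ => by rw [if_pos rfl, mul_assoc]

theorem moveMass_nonneg [Fintype L] (hD : IsMDP D) (hα : IsStrategy D α)
    (w : List L) (q : Q) (m : M) :
    0 ≤ moveMass D α w q m := by
  refine tracePathSum_nonneg fun ρ => ?_
  split_ifs
  exacts [mul_nonneg (pathProb_nonneg hD hα ρ) ((hα ρ).1 m), le_rfl]

theorem moveMass_eq_zero (hα : IsStrategy D α) (w : List L) {q : Q} {m : M}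
    (hm : m ∉ D.moves q) : moveMass D α w q m = 0 := by
  refine Finset.sum_eq_zero fun q0 _ => Finset.sum_eq_zero fun f _ => ?_
  dsimp only
  split_ifs with h
  · rw [(hα _).2.1 m (h ▸ hm), mul_zero]
  · rfl

theorem sum_moveMass (hα : IsStrategy D α) (w : List L) (q : Q) :
    ∑ m ∈ D.moves q, moveMass D α w q m = subDis D α w q := by
  simp only [subDis_eq_tracePathSum, moveMass, ← tracePathSum_sum]
  refine tracePathSum_congr fun ρ _ => ?_
  split_ifs with h
  · rw [← Finset.mul_sum, ← h, (hα ρ).2.2, mul_one]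
  · exact Finset.sum_const_zero

theorem moveMass_of_traceBased (b : List L → Q → M → ℝ) (w : List L) (q : Q) (m : M) :
    moveMass D (fun ρ => b (MPath.trace ρ) (MPath.last ρ)) w q m =
      subDis D (fun ρ => b (MPath.trace ρ) (MPath.last ρ)) w q * b w q m := by
  rw [moveMass, subDis_eq_tracePathSum, ← tracePathSum_mul_const]
  refine tracePathSum_congr fun ρ hρ => ?_
  split_ifs with h
  · rw [hρ, h]
  · rw [zero_mul]

/-- The conditional probability of choosing the move `m`, given that the trace is `w`
and the current state is `q`. -/
noncomputable def condMove (D : PreMDP Q L M) (α : MPath Q L → M → ℝ)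
    (w : List L) (q : Q) (m : M) : ℝ :=
  if subDis D α w q = 0 then α (q, []) m else moveMass D α w q m / subDis D α w q

theorem subDis_mul_condMove [Fintype L] (hD : IsMDP D) (hα : IsStrategy D α)
    (w : List L) (q : Q) (m : M) :
    subDis D α w q * condMove D α w q m = moveMass D α w q m := by
  rw [condMove]
  split_ifs with h
  · rw [h, zero_mul]
    by_cases hm : m ∈ D.moves q
    · rw [← sum_moveMass hα, Finset.sum_eq_zero_iff_of_nonneg
        fun m _ => moveMass_nonneg hD hα w q m] at h
      exact (h m hm).symm
    · exact (moveMass_eq_zero hα w hm).symm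
  · exact mul_div_cancel₀ _ h

theorem isStrategy_condMove [Fintype L] (hD : IsMDP D) (hα : IsStrategy D α) :
    IsStrategy D fun ρ => condMove D α (MPath.trace ρ) (MPath.last ρ) := by
  intro ρ
  by_cases h : subDis D α (MPath.trace ρ) (MPath.last ρ) = 0
  · simp only [condMove, if_pos h]
    exact hα (MPath.last ρ, [])
  · simp only [condMove, if_neg h]
    have hd : 0 ≤ subDis D α (MPath.trace ρ) (MPath.last ρ) := by
      rw [← sum_moveMass hα]
      exact Finset.sum_nonneg fun m _ => moveMass_nonneg hD hα _ _ m
    refine ⟨fun m => div_nonneg (moveMass_nonneg hD hα _ _ m) hd, fun m hm => ?_, ?_⟩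
    · rw [moveMass_eq_zero hα _ hm, zero_div]
    · rw [← Finset.sum_div, sum_moveMass hα, div_self h]

theorem subDis_condMove [Fintype L] (hD : IsMDP D) (hα : IsStrategy D α) (w : List L) (q : Q) :
    subDis D α w q =
      subDis D (fun ρ => condMove D α (MPath.trace ρ) (MPath.last ρ)) w q := by
  induction w using List.reverseRecOn generalizing q with
  | nil => simp [subDis, pathProb, probFrom]
  | append_singleton w a ih =>
    simp only [subDis_concat, moveMass_of_traceBased, ← ih, subDis_mul_condMove hD hα]

end SubDis

/-- For every labelled MDP `D` and every strategy `α` of `D` there exists a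
trace-based strategy `β` of `D` with `subDis_{D,α}(w) = subDis_{D,β}(w)` for all traces `w`;
in particular `Tr_{D,α} = Tr_{D,β}`. -/
theorem stmt0 {Q L M : Type*} [Fintype Q] [Fintype L] [Fintype M] [DecidableEq Q]
    (D : PreMDP Q L M) (hD : IsMDP D) (α : MPath Q L → M → ℝ) (hα : IsStrategy D α) :
    ∃ β : MPath Q L → M → ℝ, IsStrategy D β ∧ TraceBased β ∧
      (∀ w : List L, subDis D α w = subDis D β w) ∧ Tr D α = Tr D β := by
  refine ⟨fun ρ => condMove D α (MPath.trace ρ) (MPath.last ρ), isStrategy_condMove hD hα,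
    fun ρ ρ' ht hl => by simp only [ht, hl], fun w => funext (subDis_condMove hD hα w), ?_⟩
  exact funext fun w => Finset.sum_congr rfl fun q _ => subDis_condMove hD hα w q
end

section
/- Let D = ⟨Q, μ0, L, δ⟩ be a labelled MDP, let w = a1 a2 … an ∈ L*, and let μ1, μ2, …, μn be subdistributions over Q. Then there is a strategy α with μ_i = subDis_{D,α}(a1 a2 … a_i) for all i ∈ {0,1,…,n} (where μ_0 = μ0) if and only if there are local strategies α0, α1, …, α_{n−1} : Q → Dist(moves) with μ_{i+1} = Succ(μ_i, α_i, a_{i+1}) for all i ∈ {0,1,…,n−1}. -/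
open Matrix

/-- The path with initial state `q0` whose labels are `w` and whose further states are `f`. -/
def pathOf {Q L : Type*} (w : List L) (q0 : Q) (f : Fin w.length → Q) : MPath Q L :=
  (q0, List.ofFn fun i => (w.get i, f i))

/-- The integral of `G` over the paths with trace `w`, weighted by their probabilities. -/
def traceSum {Q L M : Type*} [Fintype Q] (D : PreMDP Q L M) (α : MPath Q L → M → ℝ)
    (w : List L) (G : MPath Q L → ℝ) : ℝ :=
  ∑ q0 : Q, ∑ f : Fin w.length → Q, pathProb D α (pathOf w q0 f) * G (pathOf w q0 f)

theorem MPath.last_append_singleton {Q L : Type*} (q0 : Q) (l : List (L × Q)) (a : L) (q : Q) :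
    MPath.last ((q0, l ++ [(a, q)]) : MPath Q L) = q := by
  simp [MPath.last]

theorem sum_ofFn_cons {Q L : Type*} [Fintype Q] (a : L) (w : List L) (F : List (L × Q) → ℝ) :
    ∑ f : Fin (a :: w).length → Q, F (List.ofFn fun i => ((a :: w).get i, f i)) =
      ∑ q : Q, ∑ f : Fin w.length → Q, F ((a, q) :: List.ofFn fun i => (w.get i, f i)) := by
  rw [← Fintype.sum_prod_type']
  refine (Fintype.sum_equiv (Fin.consEquiv fun _ : Fin (w.length + 1) => Q) _ _ fun x => ?_).symm
  exact congrArg F (List.ofFn_succ (f := fun i : Fin (w.length + 1) =>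
    ((a :: w).get i, (Fin.cons x.1 x.2 : Fin (w.length + 1) → Q) i))).symm

theorem sum_ofFn_append_singleton {Q L : Type*} [Fintype Q] (w : List L) (a : L)
    (F : List (L × Q) → ℝ) :
    ∑ f : Fin (w ++ [a]).length → Q, F (List.ofFn fun i => ((w ++ [a]).get i, f i)) =
      ∑ f : Fin w.length → Q, ∑ q : Q, F ((List.ofFn fun i => (w.get i, f i)) ++ [(a, q)]) := by
  induction w generalizing F with
  | nil =>
    refine (sum_ofFn_cons a [] F).trans ?_
    simp
  | cons b w ih =>
    refine (sum_ofFn_cons b (w ++ [a]) F).trans ?_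
    refine Eq.trans ?_ (sum_ofFn_cons b w fun l => ∑ q : Q, F (l ++ [(a, q)])).symm
    exact Fintype.sum_congr _ _ fun q => ih fun l => F ((b, q) :: l)

section

variable {Q L M : Type*} (D : PreMDP Q L M) (α : MPath Q L → M → ℝ)

theorem probFrom_append_singleton (l : List (L × Q)) (a : L) (q : Q) (ρ : MPath Q L) :
    probFrom D α ρ (l ++ [(a, q)]) = probFrom D α ρ l *
      ∑ m ∈ D.moves (MPath.last (ρ.1, ρ.2 ++ l)), α (ρ.1, ρ.2 ++ l) m * D.prob m a q := by
  induction l generalizing ρ with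
  | nil => simp [probFrom]
  | cons x l ih => simp [probFrom, ih, mul_assoc]

theorem pathProb_append_singleton (q0 : Q) (l : List (L × Q)) (a : L) (q : Q) :
    pathProb D α (q0, l ++ [(a, q)]) = pathProb D α (q0, l) *
      ∑ m ∈ D.moves (MPath.last (q0, l)), α (q0, l) m * D.prob m a q := by
  simp [pathProb, probFrom_append_singleton, mul_assoc]

variable {D α}

theorem probFrom_nonneg (hp : ∀ m a q', 0 ≤ D.prob m a q') (hα : IsStrategy D α)
    (l : List (L × Q)) (ρ : MPath Q L) : 0 ≤ probFrom D α ρ l := by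
  induction l generalizing ρ with
  | nil => simp [probFrom]
  | cons x l ih =>
    exact mul_nonneg (Finset.sum_nonneg fun m _ => mul_nonneg ((hα ρ).1 m) (hp _ _ _)) (ih _)

variable (D α) [Fintype Q]

theorem traceSum_sum {ι : Type*} (s : Finset ι) (w : List L) (G : ι → MPath Q L → ℝ) :
    traceSum D α w (fun ρ => ∑ i ∈ s, G i ρ) = ∑ i ∈ s, traceSum D α w (G i) := by
  simp only [traceSum, Finset.mul_sum]
  rw [Finset.sum_comm (s := s)]
  exact Fintype.sum_congr _ _ fun q0 => Finset.sum_comm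

theorem traceSum_mul_const (w : List L) (G : MPath Q L → ℝ) (c : ℝ) :
    traceSum D α w (fun ρ => G ρ * c) = traceSum D α w G * c := by
  simp only [traceSum, Finset.sum_mul, mul_assoc]

theorem traceSum_congr {w : List L} {G H : MPath Q L → ℝ}
    (h : ∀ ρ : MPath Q L, ρ.2.length = w.length → G ρ = H ρ) :
    traceSum D α w G = traceSum D α w H := by
  refine Fintype.sum_congr _ _ fun q0 => Fintype.sum_congr _ _ fun f => ?_
  rw [h _ (by simp [pathOf])]

variable [DecidableEq Q]

theorem subDis_eq_traceSum (w : List L) (q : Q) :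
    subDis D α w q = traceSum D α w fun ρ => if MPath.last ρ = q then 1 else 0 := by
  refine Fintype.sum_congr _ _ fun q0 => Fintype.sum_congr _ _ fun f => ?_
  exact (mul_boole _ _).symm

theorem subDis_nil : subDis D α [] = D.init := by
  ext q
  simp [subDis, MPath.last, pathProb, probFrom]

theorem subDis_append_singleton (w : List L) (a : L) (q' : Q) :
    subDis D α (w ++ [a]) q' =
      traceSum D α w fun ρ => ∑ m ∈ D.moves (MPath.last ρ), α ρ m * D.prob m a q' := by
  refine Fintype.sum_congr _ _ fun q0 => ?_
  refine (sum_ofFn_append_singleton w a fun l =>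
    if MPath.last ((q0, l) : MPath Q L) = q' then pathProb D α (q0, l) else 0).trans ?_
  simp [MPath.last_append_singleton, pathProb_append_singleton, pathOf]

variable {D α}

/-- One step along any strategy is a step of a local strategy that averages it correctly. -/
theorem subDis_append_singleton_eq_succ {w : List L} {γ : Q → M → ℝ}
    (h : ∀ q, ∀ m ∈ D.moves q, subDis D α w q * γ q m =
      traceSum D α w fun ρ => if MPath.last ρ = q then α ρ m else 0) (a : L) :
    subDis D α (w ++ [a]) = Succ D (subDis D α w) γ a := by
  ext q'
  have key (ρ : MPath Q L) : ∑ m ∈ D.moves (MPath.last ρ), α ρ m * D.prob m a q' =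
      ∑ q, ∑ m ∈ D.moves q, (if MPath.last ρ = q then α ρ m else 0) * D.prob m a q' := by
    rw [Fintype.sum_eq_single (MPath.last ρ)]
    · simp
    · intro q hq
      simp [hq.symm]
  rw [subDis_append_singleton]
  simp only [key, traceSum_sum, traceSum_mul_const]
  simp only [Succ, Matrix.vecMul, dotProduct, transMat, Matrix.of_apply, Finset.mul_sum]
  refine Fintype.sum_congr _ _ fun q => Finset.sum_congr rfl fun m hm => ?_
  rw [← h q m hm, mul_assoc]

/-- A strategy acts on the paths with a given trace like a local strategy. -/
theorem exists_isLocal_subDis_append_singleton (hp : ∀ m a q', 0 ≤ D.prob m a q')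
    (hi : ∀ q, 0 ≤ D.init q) {δ : Q → M → ℝ} (hδ : IsLocal D δ) (hα : IsStrategy D α)
    (w : List L) :
    ∃ γ, IsLocal D γ ∧ ∀ a, subDis D α (w ++ [a]) = Succ D (subDis D α w) γ a := by
  set T : Q → M → ℝ := fun q m =>
    traceSum D α w fun ρ => if MPath.last ρ = q then α ρ m else 0 with hT
  have hT0 (q m) : 0 ≤ T q m := by
    refine Finset.sum_nonneg fun q0 _ => Finset.sum_nonneg fun f _ => mul_nonneg
      (mul_nonneg (hi _) (probFrom_nonneg hp hα _ _)) ?_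
    dsimp only
    split_ifs
    exacts [(hα _).1 m, le_rfl]
  have hsum (q) : ∑ m ∈ D.moves q, T q m = subDis D α w q := by
    rw [subDis_eq_traceSum, ← traceSum_sum]
    congr 1
    ext ρ
    split_ifs with h
    · rw [← h, (hα ρ).2.2]
    · simp
  have hout (q m) (hm : m ∉ D.moves q) : T q m = 0 := by
    have : (fun ρ : MPath Q L => if MPath.last ρ = q then α ρ m else 0) = fun _ => 0 := by
      ext ρ
      split_ifs with h
      exacts [(hα ρ).2.1 m (h ▸ hm), rfl]
    simp only [hT, this]
    simp [traceSum]
  refine ⟨fun q m => if subDis D α w q = 0 then δ q m else T q m / subDis D α w q, fun q => ?_,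
    subDis_append_singleton_eq_succ fun q m hm => ?_⟩
  · by_cases hq : subDis D α w q = 0
    · simpa only [hq, if_true] using hδ q
    · simp only [hq, if_false]
      refine ⟨fun m => div_nonneg (hT0 q m) ?_, fun m hm => by simp [hout q m hm], ?_⟩
      · rw [← hsum]
        exact Finset.sum_nonneg fun m _ => hT0 q m
      · rw [← Finset.sum_div, hsum, div_self hq]
  · change _ = T q m
    by_cases hq : subDis D α w q = 0
    · have := (Finset.sum_eq_zero_iff_of_nonneg fun m _ => hT0 q m).1 ((hsum q).trans hq) m hm
      simp [hq, this]
    · simp only [hq, if_false]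
      field_simp

theorem subDis_append_singleton_of_forall_eq {w : List L} {γ : Q → M → ℝ}
    (h : ∀ ρ : MPath Q L, ρ.2.length = w.length → α ρ = γ (MPath.last ρ)) (a : L) :
    subDis D α (w ++ [a]) = Succ D (subDis D α w) γ a := by
  refine subDis_append_singleton_eq_succ (fun q m _ => ?_) a
  rw [subDis_eq_traceSum, ← traceSum_mul_const]
  refine traceSum_congr D α fun ρ hρ => ?_
  rw [h ρ hρ]
  split_ifs with hq <;> simp [hq]

end

theorem IsMDP.exists_isLocal {Q L M : Type*} [Fintype Q] [Fintype L] {D : PreMDP Q L M}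
    (hD : IsMDP D) : ∃ δ, IsLocal D δ := by
  classical
  choose c hc using hD.2.2.1
  refine ⟨fun q m => if m = c q then 1 else 0, fun q => ⟨fun m => ?_, fun m hm => ?_, ?_⟩⟩
  · dsimp only
    split_ifs <;> norm_num
  · exact if_neg fun h : m = c q => hm (h ▸ hc q)
  · simp [hc q]

/-- A sequence of subdistributions is generated step by step along `w`
by some strategy iff it is generated by a sequence of local strategies. -/
theorem stmt2 {Q L M : Type*} [Fintype Q] [Fintype L] [Fintype M] [DecidableEq Q]
    (D : PreMDP Q L M) (hD : IsMDP D) (w : List L)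
    (μ : Fin (w.length + 1) → Q → ℝ) (h0 : μ 0 = D.init)
    (hsub : ∀ i, IsSubDist (μ i)) :
    (∃ α : MPath Q L → M → ℝ, IsStrategy D α ∧
        ∀ i : Fin (w.length + 1), μ i = subDis D α (w.take i.val)) ↔
    (∃ β : Fin w.length → Q → M → ℝ, (∀ i, IsLocal D (β i)) ∧
        ∀ i : Fin w.length, μ i.succ = Succ D (μ i.castSucc) (β i) (w.get i)) := by
  obtain ⟨δ, hδ⟩ := hD.exists_isLocal
  have htake (i : Fin w.length) : w.take (i.val + 1) = w.take i.val ++ [w.get i] := by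
    simp
  constructor
  · rintro ⟨α, hα, hμ⟩
    choose γ hγ hs using fun i : Fin w.length =>
      exists_isLocal_subDis_append_singleton hD.2.2.2.1 hD.1 hδ hα (w.take i.val)
    refine ⟨γ, hγ, fun i => ?_⟩
    rw [hμ, hμ, Fin.val_succ, htake, hs]
    rfl
  · rintro ⟨β, hβ, hμ⟩
    refine ⟨fun ρ => if h : ρ.2.length < w.length then β ⟨_, h⟩ (MPath.last ρ)
      else δ (MPath.last ρ), fun ρ => ?_, fun i => ?_⟩
    · by_cases h : ρ.2.length < w.length
      · simpa only [h, dif_pos] using hβ ⟨_, h⟩ (MPath.last ρ)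
      · simpa only [h, dif_neg, not_false_eq_true] using hδ (MPath.last ρ)
    · induction i using Fin.induction with
      | zero => simpa [subDis_nil] using h0
      | succ i ih =>
        rw [hμ, ih, Fin.val_succ, htake]
        refine (subDis_append_singleton_of_forall_eq (fun ρ hρ => ?_) _).symm
        have hi : ρ.2.length = i.val := by simpa [i.isLt.le] using hρ
        simp [hi]
end

section
/- Let D be a labelled MDP and let C be a labelled MC over the same label alphabet L. Then D ⊑ C (i.e., for every strategy α of D, Tr_{D,α} = Tr_{C}) if and only if the initial distributions are bisimilar: μ0^D ∼ μ0^C. -/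
open Matrix

/-- The probability of performing the trace `w` after the path `ρ`. -/
def traceProbFrom {Q L M : Type*} [Fintype Q] (D : PreMDP Q L M) (α : MPath Q L → M → ℝ)
    (ρ : MPath Q L) (w : List L) : ℝ :=
  ∑ f : Fin w.length → Q, probFrom D α ρ (List.ofFn fun i => (w.get i, f i))

/-- The probability of performing the trace `w` from the state `q` when the local strategy
in use is selected by the trace performed so far. -/
def traceValue {Q L M : Type*} [Fintype Q] (D : PreMDP Q L M) :
    (List L → Q → M → ℝ) → List L → Q → ℝ
  | _, [], _ => 1
  | σ, a :: w, q =>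
      ∑ q', transMat D (σ []) a q q' * traceValue D (fun u => σ (a :: u)) w q'

/-- The trace-based strategy given by a trace-indexed family of local strategies. -/
def traceStrategy {Q L M : Type*} (σ : List L → Q → M → ℝ) (ρ : MPath Q L) : M → ℝ :=
  σ (MPath.trace ρ) (MPath.last ρ)

section

variable {Q L M : Type*}

lemma MPath.last_nil (q : Q) : MPath.last ((q, []) : MPath Q L) = q := rfl

lemma MPath.last_snoc (q₀ q : Q) (l : List (L × Q)) (a : L) :
    MPath.last ((q₀, l ++ [(a, q)]) : MPath Q L) = q := by
  simp [MPath.last]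

lemma MPath.trace_snoc (q₀ q : Q) (l : List (L × Q)) (a : L) :
    MPath.trace ((q₀, l ++ [(a, q)]) : MPath Q L) = l.map Prod.fst ++ [a] := by
  simp [MPath.trace]

lemma isStrategy_traceStrategy {D : PreMDP Q L M} {σ : List L → Q → M → ℝ}
    (hσ : ∀ u, IsLocal D (σ u)) : IsStrategy D (traceStrategy σ) :=
  fun ρ => hσ (MPath.trace ρ) (MPath.last ρ)

open Classical in
lemma isLocal_pure {D : PreMDP Q L M} {s : Q → M} (hs : ∀ q, s q ∈ D.moves q) :
    IsLocal D (fun q => Pi.single (s q) 1) := by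
  refine fun q => ⟨fun m => ?_, fun m hm => ?_, ?_⟩
  · by_cases h : m = s q
    · subst h; simp
    · simp [h]
  · exact Pi.single_eq_of_ne (fun h : m = s q => hm (h ▸ hs q)) _
  · simp [hs q]

lemma IsLocal.eq_of_card_eq_one {D : PreMDP Q L M} (h : ∀ q, (D.moves q).card = 1)
    {β γ : Q → M → ℝ} (hβ : IsLocal D β) (hγ : IsLocal D γ) : β = γ := by
  funext q m
  obtain ⟨m₀, hm₀⟩ := Finset.card_eq_one.1 (h q)
  obtain ⟨-, h1, h2⟩ := hβ q
  obtain ⟨-, h3, h4⟩ := hγ q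
  simp only [hm₀, Finset.sum_singleton, Finset.mem_singleton] at h1 h2 h3 h4
  by_cases hm : m = m₀
  · rw [hm, h2, h4]
  · rw [h1 m hm, h3 m hm]

lemma IsStrategy.eq_of_card_eq_one {D : PreMDP Q L M} (h : ∀ q, (D.moves q).card = 1)
    {α β : MPath Q L → M → ℝ} (hα : IsStrategy D α) (hβ : IsStrategy D β) : α = β := by
  funext ρ m
  obtain ⟨m₀, hm₀⟩ := Finset.card_eq_one.1 (h (MPath.last ρ))
  obtain ⟨-, h1, h2⟩ := hα ρ
  obtain ⟨-, h3, h4⟩ := hβ ρ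
  simp only [hm₀, Finset.sum_singleton, Finset.mem_singleton] at h1 h2 h3 h4
  by_cases hm : m = m₀
  · rw [hm, h2, h4]
  · rw [h1 m hm, h3 m hm]

variable [Fintype Q]

lemma traceProbFrom_nil (D : PreMDP Q L M) (α : MPath Q L → M → ℝ) (ρ : MPath Q L) :
    traceProbFrom D α ρ [] = 1 := by
  simp [traceProbFrom, probFrom]

lemma traceProbFrom_cons (D : PreMDP Q L M) (α : MPath Q L → M → ℝ) (ρ : MPath Q L) (a : L)
    (w : List L) :
    traceProbFrom D α ρ (a :: w) =
      ∑ q, (∑ m ∈ D.moves (MPath.last ρ), α ρ m * D.prob m a q) *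
        traceProbFrom D α (ρ.1, ρ.2 ++ [(a, q)]) w := by
  simp only [traceProbFrom, Finset.mul_sum]
  rw [← Fintype.sum_prod_type']
  refine ((Fin.consEquiv fun _ : Fin (w.length + 1) => Q).sum_comp _).symm.trans ?_
  refine Finset.sum_congr rfl fun p _ => ?_
  simp [List.ofFn_succ, probFrom, Fin.consEquiv]

lemma Tr_eq_sum_traceProbFrom [DecidableEq Q] (D : PreMDP Q L M) (α : MPath Q L → M → ℝ)
    (w : List L) : Tr D α w = ∑ q, D.init q * traceProbFrom D α (q, []) w := by
  simp only [Tr, subDis, traceProbFrom, Finset.mul_sum]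
  rw [Finset.sum_comm]
  refine Finset.sum_congr rfl fun q₀ _ => ?_
  rw [Finset.sum_comm]
  simp [pathProb]

lemma traceProbFrom_traceStrategy (D : PreMDP Q L M) (σ : List L → Q → M → ℝ) (w : List L) :
    ∀ ρ : MPath Q L, traceProbFrom D (traceStrategy σ) ρ w =
      traceValue D (fun u => σ (MPath.trace ρ ++ u)) w (MPath.last ρ) := by
  induction w with
  | nil => intro ρ; rw [traceProbFrom_nil, traceValue]
  | cons a w ih =>
    intro ρ
    rw [traceProbFrom_cons, traceValue]
    refine Finset.sum_congr rfl fun q _ => ?_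
    rw [ih, MPath.last_snoc, MPath.trace_snoc]
    simp [transMat, traceStrategy, MPath.trace]

lemma Tr_traceStrategy [DecidableEq Q] (D : PreMDP Q L M) (σ : List L → Q → M → ℝ)
    (w : List L) : Tr D (traceStrategy σ) w = ∑ q, D.init q * traceValue D σ w q := by
  simp [Tr_eq_sum_traceProbFrom, traceProbFrom_traceStrategy, MPath.trace, MPath.last_nil]

lemma sum_mul_traceValue_cons (D : PreMDP Q L M) (μ : Q → ℝ) (σ : List L → Q → M → ℝ) (a : L)
    (w : List L) :
    ∑ q, μ q * traceValue D σ (a :: w) q =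
      ∑ q, Succ D μ (σ []) a q * traceValue D (fun u => σ (a :: u)) w q := by
  simp only [traceValue, Succ, Matrix.vecMul, dotProduct, Finset.mul_sum, Finset.sum_mul]
  rw [Finset.sum_comm]
  simp only [mul_assoc]

/-- For every trace some trace-based strategy is optimal among all strategies; taking `c = 1`
and `c = -1` gives maximal and minimal trace probabilities. -/
lemma exists_traceValue_optimal [Fintype L] {D : PreMDP Q L M} (hD : IsMDP D) (c : ℝ)
    (w : List L) :
    ∃ σ : List L → Q → M → ℝ, (∀ u, IsLocal D (σ u)) ∧
      ∀ α, IsStrategy D α → ∀ ρ,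
        c * traceProbFrom D α ρ w ≤ c * traceValue D σ w (MPath.last ρ) := by
  classical
  obtain ⟨-, -, hne, hnn, -⟩ := hD
  induction w with
  | nil =>
    choose s hs using hne
    exact ⟨fun _ q => Pi.single (s q) 1, fun _ => isLocal_pure hs,
      fun α _ ρ => by rw [traceProbFrom_nil, traceValue]⟩
  | cons a w ih =>
    obtain ⟨σ, hσ, hopt⟩ := ih
    set g : M → ℝ := fun m => ∑ q', D.prob m a q' * (c * traceValue D σ w q') with hg
    choose s hs hmax using fun q => Finset.exists_max_image (D.moves q) g (hne q)
    refine ⟨fun u => match u with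
      | [] => fun q => Pi.single (s q) 1
      | _ :: u => σ u, ?_, fun α hα ρ => ?_⟩
    · rintro (_ | ⟨b, u⟩)
      exacts [isLocal_pure hs, hσ u]
    · obtain ⟨hα0, -, hα1⟩ := hα ρ
      have hval : c * traceValue D (fun u => match u with
          | [] => fun q => Pi.single (s q) 1
          | _ :: u => σ u) (a :: w) (MPath.last ρ) = g (s (MPath.last ρ)) := by
        simp only [traceValue, hg, Finset.mul_sum, transMat, Matrix.of_apply]
        refine Finset.sum_congr rfl fun q' _ => ?_
        rw [Finset.sum_eq_single_of_mem _ (hs _)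
          (fun m _ hm => by rw [Pi.single_eq_of_ne hm, zero_mul]), Pi.single_eq_same]
        ring
      rw [hval, traceProbFrom_cons]
      calc c * ∑ q, (∑ m ∈ D.moves (MPath.last ρ), α ρ m * D.prob m a q) *
            traceProbFrom D α (ρ.1, ρ.2 ++ [(a, q)]) w
          = ∑ q, (∑ m ∈ D.moves (MPath.last ρ), α ρ m * D.prob m a q) *
            (c * traceProbFrom D α (ρ.1, ρ.2 ++ [(a, q)]) w) := by
            rw [Finset.mul_sum]
            exact Finset.sum_congr rfl fun q _ => by ring
        _ ≤ ∑ q, (∑ m ∈ D.moves (MPath.last ρ), α ρ m * D.prob m a q) *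
            (c * traceValue D σ w q) := by
            refine Finset.sum_le_sum fun q _ => mul_le_mul_of_nonneg_left ?_
              (Finset.sum_nonneg fun m _ => mul_nonneg (hα0 m) (hnn m a q))
            simpa only [MPath.last_snoc] using hopt α hα (ρ.1, ρ.2 ++ [(a, q)])
        _ = ∑ m ∈ D.moves (MPath.last ρ), α ρ m * g m := by
            simp only [hg, Finset.sum_mul, Finset.mul_sum]
            rw [Finset.sum_comm]
            simp only [mul_assoc]
        _ ≤ ∑ m ∈ D.moves (MPath.last ρ), α ρ m * g (s (MPath.last ρ)) :=
            Finset.sum_le_sum fun m hm =>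
              mul_le_mul_of_nonneg_left (hmax _ m hm) (hα0 m)
        _ = g (s (MPath.last ρ)) := by rw [← Finset.sum_mul, hα1, one_mul]

/-- If all trace-based strategies give `w` the same probability `x`, then so do all strategies. -/
lemma Tr_eq_of_forall_traceValue_eq [Fintype L] [DecidableEq Q] {D : PreMDP Q L M}
    (hD : IsMDP D) {w : List L} {x : ℝ}
    (h : ∀ σ : List L → Q → M → ℝ, (∀ u, IsLocal D (σ u)) →
      ∑ q, D.init q * traceValue D σ w q = x)
    {α : MPath Q L → M → ℝ} (hα : IsStrategy D α) : Tr D α w = x := by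
  have key (c : ℝ) : c * Tr D α w ≤ c * x := by
    obtain ⟨σ, hσ, hopt⟩ := exists_traceValue_optimal hD c w
    rw [← h σ hσ, Tr_eq_sum_traceProbFrom, Finset.mul_sum, Finset.mul_sum]
    refine Finset.sum_le_sum fun q _ => ?_
    rw [mul_left_comm, mul_left_comm c]
    exact mul_le_mul_of_nonneg_left (hopt α hα (q, [])) (hD.1 q)
  linarith [key 1, key (-1)]

end

section

variable {QD QC L MD MC : Type*} [Fintype QD] [Fintype QC]

/-- `μ` and `ν` give every trace the same probability, under all trace-based strategies. -/
def TraceEquivalent (D : PreMDP QD L MD) (C : PreMDP QC L MC) (μ : QD → ℝ) (ν : QC → ℝ) : Prop :=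
  ∀ σ : List L → QD → MD → ℝ, (∀ u, IsLocal D (σ u)) →
    ∀ τ : List L → QC → MC → ℝ, (∀ u, IsLocal C (τ u)) →
      ∀ w, ∑ q, μ q * traceValue D σ w q = ∑ q, ν q * traceValue C τ w q

lemma TraceEquivalent.succ {D : PreMDP QD L MD} {C : PreMDP QC L MC} {μ : QD → ℝ} {ν : QC → ℝ}
    (h : TraceEquivalent D C μ ν) {β : QD → MD → ℝ} (hβ : IsLocal D β) {γ : QC → MC → ℝ}
    (hγ : IsLocal C γ) (a : L) : TraceEquivalent D C (Succ D μ β a) (Succ C ν γ a) := by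
  intro σ hσ τ hτ w
  have := h (fun u => match u with
      | [] => β
      | _ :: u => σ u) (by rintro (_ | ⟨b, u⟩); exacts [hβ, hσ u])
    (fun u => match u with
      | [] => γ
      | _ :: u => τ u) (by rintro (_ | ⟨b, u⟩); exacts [hγ, hτ u]) (a :: w)
  simpa only [sum_mul_traceValue_cons] using this

lemma isBisim_traceEquivalent {D : PreMDP QD L MD} {C : PreMDP QC L MC}
    (hD : ∃ β, IsLocal D β) (hC : ∃ γ, IsLocal C γ) : IsBisim D C (TraceEquivalent D C) := by
  obtain ⟨β₀, hβ₀⟩ := hD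
  obtain ⟨γ₀, hγ₀⟩ := hC
  refine fun μ ν h => ⟨?_, fun β hβ => ⟨γ₀, hγ₀, h.succ hβ hγ₀⟩,
    fun γ hγ => ⟨β₀, hβ₀, h.succ hβ₀ hγ⟩⟩
  simpa [traceValue] using h (fun _ => β₀) (fun _ => hβ₀) (fun _ => γ₀) (fun _ => hγ₀) []

lemma Bisim.traceEquivalent {D : PreMDP QD L MD} {C : PreMDP QC L MC}
    (hMC : ∀ q, (C.moves q).card = 1) {μ : QD → ℝ} {ν : QC → ℝ} (h : Bisim D C μ ν) :
    TraceEquivalent D C μ ν := by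
  obtain ⟨R, hR, h⟩ := h
  intro σ hσ τ hτ w
  induction w generalizing μ ν σ τ with
  | nil => simpa [traceValue] using (hR μ ν h).1
  | cons a w ih =>
    obtain ⟨γ, hγ, hsucc⟩ := (hR μ ν h).2.1 (σ []) (hσ [])
    obtain rfl := hγ.eq_of_card_eq_one hMC (hτ [])
    rw [sum_mul_traceValue_cons, sum_mul_traceValue_cons]
    exact ih (hsucc a) _ (fun u => hσ (a :: u)) _ (fun u => hτ (a :: u))

end

/-- For an MDP `D` and an MC `C` over the same label alphabet:
`D ⊑ C` (every strategy of `D` has the trace function of `C`) iff the initial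
distributions are bisimilar. -/
theorem stmt3 {QD QC L MD MC : Type*} [Fintype QD] [Fintype QC] [Fintype L] [Fintype MD]
    [Fintype MC] [DecidableEq QD] [DecidableEq QC]
    (D : PreMDP QD L MD) (C : PreMDP QC L MC) (hD : IsMDP D) (hC : IsMDP C)
    (hMC : ∀ q, (C.moves q).card = 1) :
    (∀ α, IsStrategy D α → ∀ γ, IsStrategy C γ → Tr D α = Tr C γ) ↔
      Bisim D C D.init C.init := by
  have hlocD : ∃ β, IsLocal D β := by
    choose s hs using hD.2.2.1
    exact ⟨_, isLocal_pure hs⟩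
  have hlocC : ∃ γ, IsLocal C γ := by
    choose s hs using hC.2.2.1
    exact ⟨_, isLocal_pure hs⟩
  constructor
  · intro h
    refine ⟨TraceEquivalent D C, isBisim_traceEquivalent hlocD hlocC, fun σ hσ τ hτ w => ?_⟩
    rw [← Tr_traceStrategy, ← Tr_traceStrategy,
      h _ (isStrategy_traceStrategy hσ) _ (isStrategy_traceStrategy hτ)]
  · intro h α hα γ hγ
    obtain ⟨γ₀, hγ₀⟩ := hlocC
    obtain rfl := hγ.eq_of_card_eq_one hMC (isStrategy_traceStrategy fun _ => hγ₀)
    funext w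
    rw [Tr_traceStrategy]
    exact Tr_eq_of_forall_traceValue_eq hD
      (fun σ hσ => h.traceEquivalent hMC σ hσ _ (fun _ => hγ₀) w) hα
end

section
/- Let D = ⟨Q, μ0, L, δ⟩ be a labelled MDP, let B ∈ ℝ^{Q×k} with k ≥ 1, let μ be a subdistribution over Q, and let α, α̂ be local strategies. If v ∈ ℝ^{|L|·k} is a direction in which α̂ is extremal with respect to B and p(μ,α)·v = p(μ,α̂)·v, then p(μ,α) = p(μ,α̂). -/
open Matrix

/-- The point `p(μ, β)` is linear in `μ`: it is the combination of the points of the Dirac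
distributions with coefficients `μ q`. -/
theorem point_eq_sum_single {Q L M : Type*} {k : ℕ} [Fintype Q] [DecidableEq Q]
    (D : PreMDP Q L M) (B : Matrix Q (Fin k) ℝ) (μ : Q → ℝ) (β : Q → M → ℝ) :
    point D B μ β = ∑ q, μ q • point D B (Pi.single q 1) β := by
  ext x
  simp only [point, Matrix.vecMul_vecMul, Matrix.single_one_vecMul, Finset.sum_apply,
    Pi.smul_apply, smul_eq_mul]
  rfl

/-- If `α̂` is extremal in direction `v` and `p(μ,α)·v = p(μ,α̂)·v`,
then `p(μ,α) = p(μ,α̂)`. -/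
theorem stmt5 {Q L M : Type*} {k : ℕ} [Fintype Q] [Fintype L] [Fintype M] [DecidableEq Q]
    (D : PreMDP Q L M) (hD : IsMDP D) (hk : 1 ≤ k) (B : Matrix Q (Fin k) ℝ)
    (μ : Q → ℝ) (hμ : IsSubDist μ)
    (β βh : Q → M → ℝ) (hβ : IsLocal D β) (hβh : IsLocal D βh)
    (v : L × Fin k → ℝ) (hv : ExtremalIn D B βh v)
    (heq : point D B μ β ⬝ᵥ v = point D B μ βh ⬝ᵥ v) :
    point D B μ β = point D B μ βh := by
  have key : ∀ γ, point D B μ γ ⬝ᵥ v = ∑ q, μ q * (point D B (Pi.single q 1) γ ⬝ᵥ v) := by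
    intro γ
    rw [point_eq_sum_single, sum_dotProduct]
    simp only [smul_dotProduct, smul_eq_mul]
  rw [key, key, Finset.sum_eq_sum_iff_of_le fun q _ =>
    mul_le_mul_of_nonneg_left (hv q β hβ).1 (hμ.1 q)] at heq
  rw [point_eq_sum_single D B μ β, point_eq_sum_single D B μ βh]
  refine Finset.sum_congr rfl fun q hq => ?_
  by_cases h0 : μ q = 0
  · rw [h0, zero_smul, zero_smul]
  · rw [(hv q β hβ).2 (mul_left_cancel₀ h0 (heq q hq))]
end

section
/- Let D = ⟨Q, μ0, L, δ⟩ be a labelled MDP and let B ∈ ℝ^{Q×k} with k ≥ 1. For all subdistributions μ_D, μ_E over Q: P_{μ_D} = P_{μ_E} if and only if p(μ_D, α̂) = p(μ_E, α̂) for every extremal local strategy α̂. -/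
open Matrix

lemma convex_setOf_isLocal {Q L M : Type*} (D : PreMDP Q L M) : Convex ℝ {β | IsLocal D β} := by
  intro β hβ γ hγ s t hs ht hst q
  refine ⟨fun m => ?_, fun m hm => ?_, ?_⟩
  · have := (hβ q).1 m
    have := (hγ q).1 m
    simp only [Pi.add_apply, Pi.smul_apply, smul_eq_mul]
    positivity
  · simp [(hβ q).2.1 m hm, (hγ q).2.1 m hm]
  · simp [Finset.sum_add_distrib, ← Finset.mul_sum, (hβ q).2.2, (hγ q).2.2, hst]

lemma isCompact_setOf_isLocal {Q L M : Type*} (D : PreMDP Q L M) : IsCompact {β | IsLocal D β} := by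
  have hclosed : IsClosed {β | IsLocal D β} := by
    simp only [IsLocal, Set.ofPred_forall, Set.ofPred_and]
    refine isClosed_iInter fun q => IsClosed.inter ?_ (IsClosed.inter ?_ ?_)
    · exact isClosed_iInter fun m => isClosed_le (by fun_prop) (by fun_prop)
    · exact isClosed_iInter fun m => isClosed_iInter fun _ =>
        isClosed_eq (by fun_prop) (by fun_prop)
    · exact isClosed_eq (by fun_prop) (by fun_prop)
  refine (isCompact_univ_pi fun _ : Q => isCompact_univ_pi fun _ : M =>
    isCompact_Icc (a := (0 : ℝ)) (b := 1)).of_isClosed_subset hclosed ?_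
  intro β hβ q _ m _
  refine ⟨(hβ q).1 m, ?_⟩
  by_cases hm : m ∈ D.moves q
  · rw [← (hβ q).2.2]
    exact Finset.single_le_sum (fun m _ => (hβ q).1 m) hm
  · simp [(hβ q).2.1 m hm]

lemma isLocal_single {Q L M : Type*} [DecidableEq M] {D : PreMDP Q L M} {f : Q → M}
    (hf : ∀ q, f q ∈ D.moves q) : IsLocal D fun q => Pi.single (f q) 1 := by
  refine fun q => ⟨fun m => ?_, fun m hm => ?_, ?_⟩
  · by_cases h : m = f q <;> simp [h]
  · exact Pi.single_eq_of_ne (by rintro rfl; exact hm (hf q)) _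
  · simp [Pi.single_apply, hf q]

/-- The contribution `(m(a, ·) · B)_a` of a single move `m` to the points of `D`. -/
def movePoint {Q L M : Type*} {k : ℕ} [Fintype Q] (D : PreMDP Q L M) (B : Matrix Q (Fin k) ℝ)
    (m : M) : L × Fin k → ℝ :=
  fun x => ∑ q', D.prob m x.1 q' * B q' x.2

section

variable {Q L M : Type*} {k : ℕ} [Fintype Q]

lemma point_eq_sum (D : PreMDP Q L M) (B : Matrix Q (Fin k) ℝ) (μ : Q → ℝ) (β : Q → M → ℝ) :
    point D B μ β = ∑ q, μ q • ∑ m ∈ D.moves q, β q m • movePoint D B m := by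
  ext x
  simp only [point, movePoint, transMat, vecMul, dotProduct, of_apply, Finset.sum_apply,
    Pi.smul_apply, smul_eq_mul, Finset.sum_mul, Finset.mul_sum]
  rw [Finset.sum_comm]
  refine Finset.sum_congr rfl fun q _ => ?_
  rw [Finset.sum_comm]
  refine Finset.sum_congr rfl fun m _ => Finset.sum_congr rfl fun q' _ => ?_
  ring

lemma point_single [DecidableEq Q] (D : PreMDP Q L M) (B : Matrix Q (Fin k) ℝ) (q : Q)
    (β : Q → M → ℝ) :
    point D B (Pi.single q 1) β = ∑ m ∈ D.moves q, β q m • movePoint D B m := by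
  rw [point_eq_sum, Finset.sum_eq_single q] <;> simp +contextual

lemma point_eq_sum_point_single [DecidableEq Q] (D : PreMDP Q L M) (B : Matrix Q (Fin k) ℝ)
    (μ : Q → ℝ) (β : Q → M → ℝ) :
    point D B μ β = ∑ q, μ q • point D B (Pi.single q 1) β := by
  simp only [point_single, point_eq_sum D B μ]

/-- For fixed `μ`, the point `p(μ, β)` as a linear map of `β`. -/
def pointLinearMap (D : PreMDP Q L M) (B : Matrix Q (Fin k) ℝ) (μ : Q → ℝ) :
    (Q → M → ℝ) →ₗ[ℝ] (L × Fin k → ℝ) where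
  toFun := point D B μ
  map_add' β γ := by
    simp [point_eq_sum, add_smul, Finset.sum_add_distrib]
  map_smul' c β := by
    simp [point_eq_sum, mul_smul, Finset.smul_sum, smul_comm c]

lemma Pset_eq_image (D : PreMDP Q L M) (B : Matrix Q (Fin k) ℝ) (μ : Q → ℝ) :
    Pset D B μ = pointLinearMap D B μ '' {β | IsLocal D β} := by
  ext x
  simp only [Pset, Set.mem_ofPred_eq, Set.mem_image, eq_comm (a := x)]
  rfl

lemma convex_Pset (D : PreMDP Q L M) (B : Matrix Q (Fin k) ℝ) (μ : Q → ℝ) :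
    Convex ℝ (Pset D B μ) := by
  rw [Pset_eq_image]
  exact (convex_setOf_isLocal D).linear_image _

lemma isCompact_Pset [Finite M] (D : PreMDP Q L M) (B : Matrix Q (Fin k) ℝ) (μ : Q → ℝ) :
    IsCompact (Pset D B μ) := by
  rw [Pset_eq_image]
  exact (isCompact_setOf_isLocal D).image (LinearMap.continuous_of_finiteDimensional _)

end

/-- A vector separating the distinct members of a finite family can be found in every nonempty
open set. -/
lemma dense_setOf_dotProduct_separating {ι n : Type*} [Finite ι] [Fintype n] (p : ι → n → ℝ) :
    Dense {v : n → ℝ | ∀ i j, p i ⬝ᵥ v = p j ⬝ᵥ v → p i = p j} := by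
  classical
  have key : ∀ ij : ι × ι, IsOpen {v : n → ℝ | p ij.1 ⬝ᵥ v = p ij.2 ⬝ᵥ v → p ij.1 = p ij.2} ∧
      Dense {v : n → ℝ | p ij.1 ⬝ᵥ v = p ij.2 ⬝ᵥ v → p ij.1 = p ij.2} := by
    rintro ⟨i, j⟩
    by_cases hij : p i = p j
    · simp [hij]
    let W : Submodule ℝ (n → ℝ) := LinearMap.ker (dotProductBilin ℝ ℝ (p i - p j))
    have hW : {v : n → ℝ | p i ⬝ᵥ v = p j ⬝ᵥ v → p i = p j} = (W : Set (n → ℝ))ᶜ := by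
      ext v
      simp [W, hij, sub_eq_zero]
    simp only [hW]
    refine ⟨(Submodule.closed_of_finiteDimensional W).isOpen_compl, ?_⟩
    rw [← interior_eq_empty_iff_dense_compl]
    by_contra hne
    have htop := W.eq_top_of_nonempty_interior' (Set.nonempty_iff_ne_empty.2 hne)
    have hmem : p i - p j ∈ W := htop ▸ Submodule.mem_top
    exact hij (sub_eq_zero.1 (dotProduct_self_eq_zero.1 (LinearMap.mem_ker.1 hmem)))
  have := dense_iInter_of_isOpen (fun ij => (key ij).1) fun ij => (key ij).2
  convert this using 1
  ext v
  simp [Prod.forall]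

section

variable {Q L M : Type*} {k : ℕ} [Fintype Q] [Fintype L] [Fintype M] [DecidableEq Q]
  {D : PreMDP Q L M} {B : Matrix Q (Fin k) ℝ}

lemma ExtremalIn.point_dotProduct_le {βh : Q → M → ℝ} {v : L × Fin k → ℝ}
    (h : ExtremalIn D B βh v) {μ : Q → ℝ} (hμ : ∀ q, 0 ≤ μ q) {β : Q → M → ℝ}
    (hβ : IsLocal D β) : point D B μ β ⬝ᵥ v ≤ point D B μ βh ⬝ᵥ v := by
  rw [point_eq_sum_point_single D B μ β, point_eq_sum_point_single D B μ βh]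
  simp only [sum_dotProduct, smul_dotProduct, smul_eq_mul]
  exact Finset.sum_le_sum fun q _ => mul_le_mul_of_nonneg_left (h q β hβ).1 (hμ q)

lemma ExtremalIn.point_eq_of_dotProduct_eq {βh : Q → M → ℝ} {v : L × Fin k → ℝ}
    (h : ExtremalIn D B βh v) {μ : Q → ℝ} (hμ : ∀ q, 0 ≤ μ q) {β : Q → M → ℝ}
    (hβ : IsLocal D β) (heq : point D B μ β ⬝ᵥ v = point D B μ βh ⬝ᵥ v) :
    point D B μ β = point D B μ βh := by
  rw [point_eq_sum_point_single D B μ β, point_eq_sum_point_single D B μ βh] at heq ⊢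
  simp only [sum_dotProduct, smul_dotProduct, smul_eq_mul] at heq
  have hterm := (Finset.sum_eq_sum_iff_of_le fun q _ =>
    mul_le_mul_of_nonneg_left (h q β hβ).1 (hμ q)).1 heq
  refine Finset.sum_congr rfl fun q hq => ?_
  rcases eq_or_ne (μ q) 0 with h0 | h0
  · simp [h0]
  · rw [(h q β hβ).2 (mul_left_cancel₀ h0 (hterm q hq))]

/-- In a direction separating the distinct move points, choosing an optimal move in every state
is extremal. -/
lemma extremalIn_single [DecidableEq M] {v : L × Fin k → ℝ}
    (hv : ∀ m m', movePoint D B m ⬝ᵥ v = movePoint D B m' ⬝ᵥ v →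
      movePoint D B m = movePoint D B m')
    {f : Q → M} (hf : ∀ q, f q ∈ D.moves q)
    (hmax : ∀ q, ∀ m ∈ D.moves q, movePoint D B m ⬝ᵥ v ≤ movePoint D B (f q) ⬝ᵥ v) :
    ExtremalIn D B (fun q => Pi.single (f q) 1) v := by
  intro q β hβ
  have hpt : point D B (Pi.single q 1) (fun q => Pi.single (f q) 1) =
      ∑ m ∈ D.moves q, β q m • movePoint D B (f q) := by
    rw [← Finset.sum_smul, (hβ q).2.2, point_single, Finset.sum_eq_single (f q)]
    · simp
    · intro m _ hm
      simp [hm]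
    · exact fun h => absurd (hf q) h
  rw [hpt, point_single]
  simp only [sum_dotProduct, smul_dotProduct, smul_eq_mul]
  have hle : ∀ m ∈ D.moves q, β q m * (movePoint D B m ⬝ᵥ v) ≤
      β q m * (movePoint D B (f q) ⬝ᵥ v) :=
    fun m hm => mul_le_mul_of_nonneg_left (hmax q m hm) ((hβ q).1 m)
  refine ⟨Finset.sum_le_sum hle, fun heq => Finset.sum_congr rfl fun m hm => ?_⟩
  have hterm := (Finset.sum_eq_sum_iff_of_le hle).1 heq m hm
  rcases eq_or_ne (β q m) 0 with h0 | h0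
  · simp [h0]
  · rw [hv _ _ (mul_left_cancel₀ h0 hterm)]

lemma point_eq_of_Pset_eq {μ ν : Q → ℝ} (hμ : ∀ q, 0 ≤ μ q) (hν : ∀ q, 0 ≤ ν q)
    (h : Pset D B μ = Pset D B ν) {βh : Q → M → ℝ} (hβh : IsLocal D βh)
    (hext : Extremal D B βh) : point D B μ βh = point D B ν βh := by
  obtain ⟨v, hv⟩ := hext
  obtain ⟨β, hβ, hμβ⟩ : point D B μ βh ∈ Pset D B ν := h ▸ ⟨βh, hβh, rfl⟩
  obtain ⟨γ, hγ, hνγ⟩ : point D B ν βh ∈ Pset D B μ := h ▸ ⟨βh, hβh, rfl⟩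
  rw [hμβ]
  refine hv.point_eq_of_dotProduct_eq hν hβ (le_antisymm (hv.point_dotProduct_le hν hβ) ?_)
  rw [← hμβ, hνγ]
  exact hv.point_dotProduct_le hμ hγ

lemma Pset_subset_of_point_eq (hne : ∀ q, (D.moves q).Nonempty) {μ ν : Q → ℝ}
    (hμ : ∀ q, 0 ≤ μ q)
    (h : ∀ βh, IsLocal D βh → Extremal D B βh → point D B μ βh = point D B ν βh) :
    Pset D B μ ⊆ Pset D B ν := by
  classical
  rintro x ⟨β, hβ, rfl⟩
  by_contra hx
  obtain ⟨g, u, hgν, hgx⟩ := geometric_hahn_banach_closed_point (convex_Pset D B ν)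
    (isCompact_Pset D B ν).isClosed hx
  let w : L × Fin k → ℝ := fun i => g (Pi.single i 1)
  have hw : ∀ y, g y = y ⬝ᵥ w := fun y => by
    conv_lhs => rw [pi_eq_sum_univ' y]
    simp [dotProduct, w, map_sum, Pi.single]
  let U : Set (L × Fin k → ℝ) := ⋂ f : {f : Q → M // ∀ q, f q ∈ D.moves q},
    {v | point D B ν (fun q => Pi.single (f.1 q) 1) ⬝ᵥ v < point D B μ β ⬝ᵥ v}
  have hU : IsOpen U := isOpen_iInter_of_finite fun f =>
    isOpen_lt (by fun_prop) (by fun_prop)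
  have hwU : w ∈ U := Set.mem_iInter.2 fun f => by
    simp only [Set.mem_ofPred_eq, ← hw]
    exact (hgν _ ⟨_, isLocal_single f.2, rfl⟩).trans hgx
  obtain ⟨v, hvU, hv⟩ :=
    (dense_setOf_dotProduct_separating (movePoint D B)).inter_open_nonempty U hU ⟨w, hwU⟩
  choose f hf hmax using fun q =>
    Finset.exists_max_image (D.moves q) (fun m => movePoint D B m ⬝ᵥ v) (hne q)
  have hext := extremalIn_single hv hf hmax
  have hlt : point D B ν (fun q => Pi.single (f q) 1) ⬝ᵥ v < point D B μ β ⬝ᵥ v :=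
    Set.mem_iInter.1 hvU ⟨f, hf⟩
  rw [← h _ (isLocal_single hf) ⟨v, hext⟩] at hlt
  exact hlt.not_ge (hext.point_dotProduct_le hμ hβ)

end

/-- `P_{μ_D} = P_{μ_E}` iff `p(μ_D, α̂) = p(μ_E, α̂)` for every extremal
local strategy `α̂`. -/
theorem stmt7 {Q L M : Type*} {k : ℕ} [Fintype Q] [Fintype L] [Fintype M] [DecidableEq Q]
    (D : PreMDP Q L M) (hD : IsMDP D) (hk : 1 ≤ k) (B : Matrix Q (Fin k) ℝ)
    (μD μE : Q → ℝ) (hμD : IsSubDist μD) (hμE : IsSubDist μE) :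
    Pset D B μD = Pset D B μE ↔
      ∀ βh, IsLocal D βh → Extremal D B βh → point D B μD βh = point D B μE βh := by
  exact ⟨fun h _ hβh hext => point_eq_of_Pset_eq hμD.1 hμE.1 h hβh hext, fun h =>
    (Pset_subset_of_point_eq hD.2.2.1 hμD.1 h).antisymm
      (Pset_subset_of_point_eq hD.2.2.1 hμE.1 fun βh hβh hext => (h βh hβh hext).symm)⟩
end

section
/- Let D = ⟨Q, μ0, L, δ⟩ be a labelled MDP, let n ≥ 0 and k ≥ 1, and suppose B ∈ ℝ^{Q×k} is a matrix such that for all subdistributions μ_D, μ_E over Q: μ_D ∼_n μ_E if and only if μ_D·B = μ_E·B. Then for all subdistributions μ_D, μ_E over Q: μ_D ∼_{n+1} μ_E if and only if μ_D·B = μ_E·B and P_{μ_D} = P_{μ_E}. -/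
open Matrix

/-- The successor of a subdistribution under a local strategy is a subdistribution. -/
theorem IsSubDist.succ {Q L M : Type*} [Fintype Q] [Fintype L] {D : PreMDP Q L M}
    (hD : IsMDP D) {μ : Q → ℝ} (hμ : IsSubDist μ) {β : Q → M → ℝ} (hβ : IsLocal D β) (a : L) :
    IsSubDist (Succ D μ β a) := by
  obtain ⟨-, -, -, hprob, hsum⟩ := hD
  have hT : ∀ q q', 0 ≤ transMat D β a q q' := fun q q' =>
    Finset.sum_nonneg fun m _ => mul_nonneg ((hβ q).1 m) (hprob m a q')
  have hrow : ∀ q, ∑ q', transMat D β a q q' ≤ 1 := by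
    intro q
    calc ∑ q', transMat D β a q q'
        = ∑ m ∈ D.moves q, β q m * ∑ q', D.prob m a q' := by
          simp only [transMat, Matrix.of_apply, Finset.mul_sum]
          exact Finset.sum_comm
      _ ≤ ∑ m ∈ D.moves q, β q m := by
          refine Finset.sum_le_sum fun m hm => mul_le_of_le_one_right ((hβ q).1 m) ?_
          rw [← hsum q m hm]
          exact Finset.single_le_sum (f := fun a => ∑ q', D.prob m a q')
            (fun b _ => Finset.sum_nonneg fun q' _ => hprob m b q') (Finset.mem_univ a)
      _ = 1 := (hβ q).2.2
  refine ⟨fun q' => Finset.sum_nonneg fun q _ => mul_nonneg (hμ.1 q) (hT q q'), ?_⟩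
  calc ∑ q', Succ D μ β a q' = ∑ q, μ q * ∑ q', transMat D β a q q' := by
        simp only [Succ, Matrix.vecMul, dotProduct, Finset.mul_sum]
        exact Finset.sum_comm
    _ ≤ ∑ q, μ q := Finset.sum_le_sum fun q _ => mul_le_of_le_one_right (hμ.1 q) (hrow q)
    _ ≤ 1 := hμ.2

/-- The approximants `∼ₙ` preserve the total mass. -/
theorem simN.sum_eq {Q L M : Type*} [Fintype Q] {D : PreMDP Q L M} {n : ℕ} {μ ν : Q → ℝ}
    (h : simN D n μ ν) : ∑ q, μ q = ∑ q, ν q := by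
  cases n with
  | zero => exact h
  | succ n => exact h.1

/-- The approximants `∼ₙ` are decreasing in `n`. -/
theorem simN.of_succ {Q L M : Type*} [Fintype Q] {D : PreMDP Q L M} {n : ℕ} {μ ν : Q → ℝ}
    (h : simN D (n + 1) μ ν) : simN D n μ ν := by
  induction n generalizing μ ν with
  | zero => exact h.1
  | succ n ih =>
    refine ⟨h.1, fun β hβ => ?_, fun γ hγ => ?_⟩
    · obtain ⟨γ, hγ, hs⟩ := h.2.1 β hβ
      exact ⟨γ, hγ, fun a => ih (hs a)⟩
    · obtain ⟨β, hβ, hs⟩ := h.2.2 γ hγ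
      exact ⟨β, hβ, fun a => ih (hs a)⟩

theorem point_eq_point_iff {Q L M : Type*} {k : ℕ} [Fintype Q] (D : PreMDP Q L M)
    (B : Matrix Q (Fin k) ℝ) (μ ν : Q → ℝ) (β γ : Q → M → ℝ) :
    point D B μ β = point D B ν γ ↔
      ∀ a, Matrix.vecMul (Succ D μ β a) B = Matrix.vecMul (Succ D ν γ a) B := by
  simp only [funext_iff, Prod.forall, point, Succ]

/-- If `B` characterizes `∼ₙ`, then `∼ₙ₊₁` is characterized by
agreement under `B` together with equality of the polytopes `P_{μ_D}` and `P_{μ_E}`. -/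
theorem stmt10 {Q L M : Type*} {k : ℕ} [Fintype Q] [Fintype L] [Fintype M] [DecidableEq Q]
    (D : PreMDP Q L M) (hD : IsMDP D) (n : ℕ) (hk : 1 ≤ k) (B : Matrix Q (Fin k) ℝ)
    (hB : ∀ μD μE : Q → ℝ, IsSubDist μD → IsSubDist μE →
      (simN D n μD μE ↔ Matrix.vecMul μD B = Matrix.vecMul μE B)) :
    ∀ μD μE : Q → ℝ, IsSubDist μD → IsSubDist μE →
      (simN D (n + 1) μD μE ↔
        (Matrix.vecMul μD B = Matrix.vecMul μE B ∧ Pset D B μD = Pset D B μE)) := by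
  intro μ ν hμ hν
  have key : ∀ β γ, IsLocal D β → IsLocal D γ →
      ((∀ a, simN D n (Succ D μ β a) (Succ D ν γ a)) ↔ point D B μ β = point D B ν γ) :=
    fun β γ hβ hγ => (forall_congr' fun a => hB _ _ (hμ.succ hD hβ a) (hν.succ hD hγ a)).trans
      (point_eq_point_iff D B μ ν β γ).symm
  constructor
  · intro h
    refine ⟨(hB μ ν hμ hν).1 h.of_succ, Set.Subset.antisymm ?_ ?_⟩
    · rintro _ ⟨β, hβ, rfl⟩
      obtain ⟨γ, hγ, hs⟩ := h.2.1 β hβ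
      exact ⟨γ, hγ, (key β γ hβ hγ).1 hs⟩
    · rintro _ ⟨γ, hγ, rfl⟩
      obtain ⟨β, hβ, hs⟩ := h.2.2 γ hγ
      exact ⟨β, hβ, ((key β γ hβ hγ).1 hs).symm⟩
  · rintro ⟨hb, hP⟩
    refine ⟨((hB μ ν hμ hν).2 hb).sum_eq, fun β hβ => ?_, fun γ hγ => ?_⟩
    · obtain ⟨γ, hγ, e⟩ := hP.subset ⟨β, hβ, rfl⟩
      exact ⟨γ, hγ, (key β γ hβ hγ).2 e⟩
    · obtain ⟨β, hβ, e⟩ := hP.superset ⟨γ, hγ, rfl⟩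
      exact ⟨β, hβ, (key β γ hβ hγ).2 e.symm⟩
end

section
/- Let D = ⟨Q, μ0^D, L, δ⟩ be a labelled MDP and let C = ⟨Q_C, μ0^C, L, δ⟩ be a labelled MC with Q_C ⊆ Q. Define subspaces of ℝ^Q: V_0 = span{1} (the all-ones vector), and V_{n+1} is the smallest vector space containing V_n and containing Δ_α(a)·u for all u ∈ V_n, all a ∈ L, and all local strategies α. Let V = V_s where s is the smallest index with V_s = V_{s+1}; then s ≤ |Q|−1, and for all subdistributions μ_D over Q and μ_C over Q_C: μ_D ∼ μ_C if and only if μ_D·u = μ_C·u for all u ∈ V. -/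
open Matrix

/-- `μ` is supported in the set `S`. -/
def SuppIn {Q : Type*} (μ : Q → ℝ) (S : Finset Q) : Prop := ∀ q ∉ S, μ q = 0

/-- The sequence of subspaces `V_0 = span{1}`,
`V_{n+1} = V_n + span{Δ_α(a)·u : u ∈ V_n, a ∈ L, α a local strategy}`. -/
def VseqAll {Q L M : Type*} [Fintype Q] (D : PreMDP Q L M) : ℕ → Submodule ℝ (Q → ℝ)
  | 0 => Submodule.span ℝ {fun _ => (1 : ℝ)}
  | n + 1 => VseqAll D n ⊔ Submodule.span ℝ
      { x | ∃ u ∈ VseqAll D n, ∃ a : L, ∃ β : Q → M → ℝ, IsLocal D β ∧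
          x = Matrix.mulVec (transMat D β a) u }

lemma transMat_eq_of_card_moves_eq_one {Q L M : Type*} (D : PreMDP Q L M) {q : Q}
    (hq : (D.moves q).card = 1) {β γ : Q → M → ℝ} (hβ : IsLocal D β) (hγ : IsLocal D γ) (a : L) :
    transMat D β a q = transMat D γ a q := by
  obtain ⟨m, hm⟩ := Finset.card_eq_one.mp hq
  have h₁ := (hβ q).2.2
  have h₂ := (hγ q).2.2
  rw [hm, Finset.sum_singleton] at h₁ h₂
  ext q'
  simp [transMat, hm, h₁, h₂]

section VseqAll

variable {Q L M : Type*} [Fintype Q]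

lemma vseqAll_le_succ (D : PreMDP Q L M) (n : ℕ) : VseqAll D n ≤ VseqAll D (n + 1) :=
  le_sup_left

lemma transMat_mulVec_mem_vseqAll_succ (D : PreMDP Q L M) {n : ℕ} {u : Q → ℝ}
    (hu : u ∈ VseqAll D n) (a : L) {β : Q → M → ℝ} (hβ : IsLocal D β) :
    transMat D β a *ᵥ u ∈ VseqAll D (n + 1) :=
  le_sup_right (a := VseqAll D n) (Submodule.subset_span ⟨u, hu, a, β, hβ, rfl⟩)

lemma one_mem_vseqAll (D : PreMDP Q L M) (n : ℕ) : (fun _ => (1 : ℝ)) ∈ VseqAll D n := by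
  induction n with
  | zero => exact Submodule.subset_span rfl
  | succ n ih => exact vseqAll_le_succ D n ih

lemma succ_dotProduct (D : PreMDP Q L M) (μ : Q → ℝ) (β : Q → M → ℝ) (a : L) (u : Q → ℝ) :
    Succ D μ β a ⬝ᵥ u = μ ⬝ᵥ (transMat D β a *ᵥ u) :=
  (Matrix.dotProduct_mulVec _ _ _).symm

/-- As long as the sequence `VseqAll` has not stabilized, its dimension grows at each step. -/
lemma succ_le_finrank_vseqAll [Nonempty Q] (D : PreMDP Q L M) (n : ℕ)
    (hn : ∀ t < n, VseqAll D t ≠ VseqAll D (t + 1)) :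
    n + 1 ≤ Module.finrank ℝ (VseqAll D n) := by
  induction n with
  | zero =>
    refine (finrank_span_singleton (K := ℝ) (v := fun _ : Q => (1 : ℝ)) fun h => ?_).ge
    exact one_ne_zero (congrFun h (Classical.arbitrary Q))
  | succ n ih =>
    have hlt := Submodule.finrank_lt_finrank_of_lt
      ((vseqAll_le_succ D n).lt_of_ne (hn n n.lt_succ_self))
    have := ih fun t ht => hn t (ht.trans n.lt_succ_self)
    omega

/-- Agreement on a stable member of `VseqAll` is a bisimulation. -/
lemma isBisim_of_vseqAll_eq_succ (D : PreMDP Q L M) {s : ℕ}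
    (hfix : VseqAll D s = VseqAll D (s + 1)) :
    IsBisim D D fun μ ν => ∀ u ∈ VseqAll D s, μ ⬝ᵥ u = ν ⬝ᵥ u := by
  intro μ ν h
  have step : ∀ β, IsLocal D β → ∀ a, ∀ u ∈ VseqAll D s,
      Succ D μ β a ⬝ᵥ u = Succ D ν β a ⬝ᵥ u := fun β hβ a u hu => by
    rw [succ_dotProduct, succ_dotProduct]
    exact h _ (hfix ▸ transMat_mulVec_mem_vseqAll_succ D hu a hβ)
  refine ⟨?_, fun β hβ => ⟨β, hβ, step β hβ⟩, fun γ hγ => ⟨γ, hγ, step γ hγ⟩⟩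
  simpa [dotProduct] using h _ (one_mem_vseqAll D s)

lemma succ_eq_of_suppIn (D : PreMDP Q L M) {S : Finset Q}
    (hone : ∀ q ∈ S, (D.moves q).card = 1) {ν : Q → ℝ} (hν : SuppIn ν S)
    {β γ : Q → M → ℝ} (hβ : IsLocal D β) (hγ : IsLocal D γ) (a : L) :
    Succ D ν β a = Succ D ν γ a := by
  ext q'
  refine Finset.sum_congr rfl fun q _ => ?_
  by_cases hq : q ∈ S
  · exact congrArg (ν q * ·)
      (congrFun (transMat_eq_of_card_moves_eq_one D (hone q hq) hβ hγ a) q')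
  · simp [hν q hq]

lemma SuppIn.succ (D : PreMDP Q L M) {S : Finset Q}
    (hclosed : ∀ q ∈ S, ∀ m ∈ D.moves q, ∀ (a : L) (q' : Q), D.prob m a q' ≠ 0 → q' ∈ S)
    {ν : Q → ℝ} (hν : SuppIn ν S) (β : Q → M → ℝ) (a : L) : SuppIn (Succ D ν β a) S := by
  intro q' hq'
  refine Finset.sum_eq_zero fun q _ => ?_
  by_cases hq : q ∈ S
  · refine mul_eq_zero_of_right _ (Finset.sum_eq_zero fun m hm => mul_eq_zero_of_right _ ?_)
    exact by_contra fun h => hq' (hclosed q hq m hm a q' h)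
  · simp [hν q hq]

/-- A subdistribution bisimilar to one on a closed set of states with unique moves agrees with
it on every `VseqAll D n`. -/
lemma IsBisim.dotProduct_eq {D : PreMDP Q L M} {R : (Q → ℝ) → (Q → ℝ) → Prop}
    (hR : IsBisim D D R) {S : Finset Q} (hone : ∀ q ∈ S, (D.moves q).card = 1)
    (hclosed : ∀ q ∈ S, ∀ m ∈ D.moves q, ∀ (a : L) (q' : Q), D.prob m a q' ≠ 0 → q' ∈ S)
    (n : ℕ) {μ ν : Q → ℝ} (h : R μ ν) (hν : SuppIn ν S) :
    ∀ u ∈ VseqAll D n, μ ⬝ᵥ u = ν ⬝ᵥ u := by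
  induction n generalizing μ ν with
  | zero =>
    intro u hu
    obtain ⟨c, rfl⟩ := Submodule.mem_span_singleton.mp hu
    rw [dotProduct_smul, dotProduct_smul]
    simpa [dotProduct] using Or.inl (hR μ ν h).1
  | succ n ih =>
    intro u hu
    obtain ⟨v, hv, w, hw, rfl⟩ := Submodule.mem_sup.mp hu
    rw [dotProduct_add, dotProduct_add, ih h hν v hv]
    congr 1
    clear hu
    induction hw using Submodule.span_induction with
    | mem x hx =>
      obtain ⟨u, hu, a, β, hβ, rfl⟩ := hx
      obtain ⟨γ, hγ, hstep⟩ := (hR μ ν h).2.1 β hβ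
      have := ih (hstep a) (hν.succ D hclosed γ a) u hu
      rwa [succ_eq_of_suppIn D hone hν hγ hβ a, succ_dotProduct, succ_dotProduct] at this
    | zero => simp
    | add x y _ _ hx hy => rw [dotProduct_add, dotProduct_add, hx, hy]
    | smul c x _ hx => rw [dotProduct_smul, dotProduct_smul, hx]

end VseqAll

/-- For an MDP `D` and an MC given by a closed subset `QC` of states of
`D` with unique moves: the sequence `V_n` stabilizes at some `s ≤ |Q| − 1`, and bisimilarity
of a subdistribution of `D` with a subdistribution supported on `QC` is characterized by
agreement on `V = V_s`. -/
theorem stmt14 {Q L M : Type*} [Fintype Q] [Fintype L] [Fintype M] [DecidableEq Q]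
    (D : PreMDP Q L M) (hD : IsMDP D) (QC : Finset Q)
    (hone : ∀ q ∈ QC, (D.moves q).card = 1)
    (hclosed : ∀ q ∈ QC, ∀ m ∈ D.moves q, ∀ (a : L) (q' : Q), D.prob m a q' ≠ 0 → q' ∈ QC)
    (s : ℕ) (hfix : VseqAll D s = VseqAll D (s + 1))
    (hmin : ∀ t < s, VseqAll D t ≠ VseqAll D (t + 1)) :
    s ≤ Fintype.card Q - 1 ∧
      ∀ μD μC : Q → ℝ, IsSubDist μD → IsSubDist μC → SuppIn μC QC →
        (Bisim D D μD μC ↔ ∀ u ∈ VseqAll D s, μD ⬝ᵥ u = μC ⬝ᵥ u) := by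
  have : Nonempty Q := by
    by_contra h
    rw [not_nonempty_iff] at h
    simpa using hD.2.1
  refine ⟨?_, fun μD μC _ _ hμC => ⟨?_, fun h => ⟨_, isBisim_of_vseqAll_eq_succ D hfix, h⟩⟩⟩
  · have h₁ := succ_le_finrank_vseqAll D s hmin
    have h₂ := (VseqAll D s).finrank_le
    rw [Module.finrank_fintype_fun_eq_card] at h₂
    omega
  · rintro ⟨R, hR, h⟩
    exact hR.dotProduct_eq hone hclosed s h hμC
end
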